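/- arXiv:2404.09867 — 5 statements merged into one kernel-verified Lean document; each statement's English description precedes it below -/
import Mathlib

section
/- Let V₁ be the ℂ-vector space with basis (g, eP, eQ, eR, eC, eL1, eL2), V₂ the ℂ-vector space with basis (g2, eP2, eQ2, eR2, geC, geL1, geL2), and μ : V₁ × V₁ → V₂ the symmetric bilinear map given by the multiplication table below. Then the subspace I := μ(V₁, eC − eR) + μ(V₁, eR + eL1 + eL2) of V₂ (the span of all μ(v, eC − eR) and μ(v, eR + eL1 + eL2) with v ∈ V₁) equals the 5-dimensional span of geC, eR2, eP2 + eQ2, geL1 + geL2, and g2. -/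
/-- The standard basis vectors of `ℂ⁷`.  We use this both for
`V₁ = H^{1,1}(X)` with basis `(g, eP, eQ, eR, eC, eL1, eL2)` (indices `0,…,6`) and for
`V₂ = H^{2,2}(X)` with basis `(g2, eP2, eQ2, eR2, geC, geL1, geL2)` (indices `0,…,6`). -/
noncomputable def e (i : Fin 7) : Fin 7 → ℂ := Pi.single i 1

theorem sum_smul_e (v : Fin 7 → ℂ) : ∑ i, v i • e i = v := by
  simpa [e] using (Pi.basisFun ℂ (Fin 7)).sum_repr v

theorem range_le_of_e {f : (Fin 7 → ℂ) →ₗ[ℂ] (Fin 7 → ℂ)} {S : Submodule ℂ (Fin 7 → ℂ)}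
    (h : ∀ i, f (e i) ∈ S) : LinearMap.range f ≤ S := by
  rintro _ ⟨v, rfl⟩
  rw [← sum_smul_e v, map_sum]
  exact S.sum_mem fun i _ => by
    rw [map_smul]
    exact S.smul_mem _ (h i)

theorem linearIndependent_generators :
    LinearIndependent ℂ ![e 4, e 3, e 1 + e 2, e 5 + e 6, e 0] := by
  rw [Fintype.linearIndependent_iff]
  intro c hc
  have h0 := congrFun hc 0
  have h1 := congrFun hc 1
  have h3 := congrFun hc 3
  have h4 := congrFun hc 4
  have h5 := congrFun hc 5
  simp [Fin.sum_univ_succ, e] at h0 h1 h3 h4 h5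
  intro i
  fin_cases i <;> assumption

theorem finrank_span_generators :
    Module.finrank ℂ
      (Submodule.span ℂ {e 4, e 3, e 1 + e 2, e 5 + e 6, e 0} : Submodule ℂ (Fin 7 → ℂ)) = 5 := by
  have hrange : Set.range ![e 4, e 3, e 1 + e 2, e 5 + e 6, e 0] =
      {e 4, e 3, e 1 + e 2, e 5 + e 6, e 0} := by
    ext x
    simp only [Set.mem_range, Fin.exists_fin_succ, Set.mem_insert_iff, Set.mem_singleton_iff]
    simp [eq_comm]
  rw [← hrange, finrank_span_eq_card linearIndependent_generators, Fintype.card_fin]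

/-- Let `μ : V₁ × V₁ → V₂` be the symmetric bilinear multiplication map
`H^{1,1}(X) × H^{1,1}(X) → H^{2,2}(X)` given by the multiplication table of the paper.
Then the indeterminacy subspace `I = μ(V₁, eC − eR) + μ(V₁, eR + eL1 + eL2)` equals the
5-dimensional span of `geC, eR2, eP2 + eQ2, geL1 + geL2, g2`. -/
theorem indeterminacy_eq_span
    (μ : (Fin 7 → ℂ) →ₗ[ℂ] (Fin 7 → ℂ) →ₗ[ℂ] (Fin 7 → ℂ))
    (hsymm : ∀ v w, μ v w = μ w v)
    -- row g
    (h00 : μ (e 0) (e 0) = e 0)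
    (h01 : μ (e 0) (e 1) = 0)
    (h02 : μ (e 0) (e 2) = 0)
    (h03 : μ (e 0) (e 3) = 0)
    (h04 : μ (e 0) (e 4) = e 4)
    (h05 : μ (e 0) (e 5) = e 5)
    (h06 : μ (e 0) (e 6) = e 6)
    -- row eP
    (h11 : μ (e 1) (e 1) = e 1)
    (h12 : μ (e 1) (e 2) = 0)
    (h13 : μ (e 1) (e 3) = 0)
    (h14 : μ (e 1) (e 4) = e 4)
    (h15 : μ (e 1) (e 5) = 0)
    (h16 : μ (e 1) (e 6) = 0)
    -- row eQ
    (h22 : μ (e 2) (e 2) = e 2)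
    (h23 : μ (e 2) (e 3) = 0)
    (h24 : μ (e 2) (e 4) = e 4)
    (h25 : μ (e 2) (e 5) = 0)
    (h26 : μ (e 2) (e 6) = 0)
    -- row eR
    (h33 : μ (e 3) (e 3) = e 3)
    (h34 : μ (e 3) (e 4) = 0)
    (h35 : μ (e 3) (e 5) = e 5)
    (h36 : μ (e 3) (e 6) = e 6)
    -- row eC
    (h44 : μ (e 4) (e 4) = (-2 : ℂ) • e 4 - e 0 - e 1 - e 2)
    (h45 : μ (e 4) (e 5) = e 5)
    (h46 : μ (e 4) (e 6) = e 6)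
    -- row eL1
    (h55 : μ (e 5) (e 5) = - e 5 - e 0 - e 3 + e 4)
    (h56 : μ (e 5) (e 6) = 0)
    -- row eL2
    (h66 : μ (e 6) (e 6) = - e 6 - e 0 - e 3 + e 4) :
    LinearMap.range (μ.flip (e 4 - e 3)) ⊔ LinearMap.range (μ.flip (e 3 + e 5 + e 6))
      = Submodule.span ℂ {e 4, e 3, e 1 + e 2, e 5 + e 6, e 0} ∧
    Module.finrank ℂ
      (Submodule.span ℂ {e 4, e 3, e 1 + e 2, e 5 + e 6, e 0} : Submodule ℂ (Fin 7 → ℂ)) = 5 := by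
  refine ⟨?_, finrank_span_generators⟩
  set S : Submodule ℂ (Fin 7 → ℂ) :=
    Submodule.span ℂ {e 4, e 3, e 1 + e 2, e 5 + e 6, e 0} with hS
  have m4 : e 4 ∈ S := Submodule.subset_span (by simp)
  have m3 : e 3 ∈ S := Submodule.subset_span (by simp)
  have m12 : e 1 + e 2 ∈ S := Submodule.subset_span (by simp)
  have m56 : e 5 + e 6 ∈ S := Submodule.subset_span (by simp)
  have m0 : e 0 ∈ S := Submodule.subset_span (by simp)
  have a0 : μ.flip (e 4 - e 3) (e 0) = e 4 := by simp [h04, h03]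
  have a1 : μ.flip (e 4 - e 3) (e 1) = e 4 := by simp [h14, h13]
  have a2 : μ.flip (e 4 - e 3) (e 2) = e 4 := by simp [h24, h23]
  have a3 : μ.flip (e 4 - e 3) (e 3) = -e 3 := by simp [h34, h33]
  have a4 : μ.flip (e 4 - e 3) (e 4) = (-2 : ℂ) • e 4 - e 0 - (e 1 + e 2) := by
    simp [h44, hsymm (e 4) (e 3), h34]
    abel
  have a5 : μ.flip (e 4 - e 3) (e 5) = 0 := by
    simp [hsymm (e 5) (e 4), hsymm (e 5) (e 3), h45, h35]
  have a6 : μ.flip (e 4 - e 3) (e 6) = 0 := by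
    simp [hsymm (e 6) (e 4), hsymm (e 6) (e 3), h46, h36]
  have b0 : μ.flip (e 3 + e 5 + e 6) (e 0) = e 5 + e 6 := by simp [h03, h05, h06]
  have b1 : μ.flip (e 3 + e 5 + e 6) (e 1) = 0 := by simp [h13, h15, h16]
  have b2 : μ.flip (e 3 + e 5 + e 6) (e 2) = 0 := by simp [h23, h25, h26]
  have b3 : μ.flip (e 3 + e 5 + e 6) (e 3) = e 3 + (e 5 + e 6) := by
    simp [h33, h35, h36, add_assoc]
  have b4 : μ.flip (e 3 + e 5 + e 6) (e 4) = e 5 + e 6 := by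
    simp [hsymm (e 4) (e 3), h34, h45, h46]
  have b5 : μ.flip (e 3 + e 5 + e 6) (e 5) = e 4 - e 3 - e 0 := by
    simp [hsymm (e 5) (e 3), h35, h55, h56]
    abel
  have b6 : μ.flip (e 3 + e 5 + e 6) (e 6) = e 4 - e 3 - e 0 := by
    simp [hsymm (e 6) (e 3), hsymm (e 6) (e 5), h36, h56, h66]
    abel
  apply le_antisymm
  · refine sup_le (range_le_of_e fun i => ?_) (range_le_of_e fun i => ?_)
    · fin_cases i
      · exact Set.mem_of_eq_of_mem a0 m4
      · exact Set.mem_of_eq_of_mem a1 m4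
      · exact Set.mem_of_eq_of_mem a2 m4
      · exact Set.mem_of_eq_of_mem a3 (S.neg_mem m3)
      · exact Set.mem_of_eq_of_mem a4 (S.sub_mem (S.sub_mem (S.smul_mem _ m4) m0) m12)
      · exact Set.mem_of_eq_of_mem a5 S.zero_mem
      · exact Set.mem_of_eq_of_mem a6 S.zero_mem
    · fin_cases i
      · exact Set.mem_of_eq_of_mem b0 m56
      · exact Set.mem_of_eq_of_mem b1 S.zero_mem
      · exact Set.mem_of_eq_of_mem b2 S.zero_mem
      · exact Set.mem_of_eq_of_mem b3 (S.add_mem m3 m56)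
      · exact Set.mem_of_eq_of_mem b4 m56
      · exact Set.mem_of_eq_of_mem b5 (S.sub_mem (S.sub_mem m4 m3) m0)
      · exact Set.mem_of_eq_of_mem b6 (S.sub_mem (S.sub_mem m4 m3) m0)
  · set T := LinearMap.range (μ.flip (e 4 - e 3)) ⊔ LinearMap.range (μ.flip (e 3 + e 5 + e 6))
    have hA (v) : μ.flip (e 4 - e 3) v ∈ T := Submodule.mem_sup_left ⟨v, rfl⟩
    have hB (v) : μ.flip (e 3 + e 5 + e 6) v ∈ T := Submodule.mem_sup_right ⟨v, rfl⟩
    have t4 : e 4 ∈ T := a0 ▸ hA (e 0)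
    have t3 : e 3 ∈ T := neg_mem_iff.mp (a3 ▸ hA (e 3))
    have t56 : e 5 + e 6 ∈ T := b0 ▸ hB (e 0)
    have t0 : e 0 ∈ T := by
      have h := T.sub_mem (T.sub_mem t4 t3) (b5 ▸ hB (e 5))
      rwa [sub_sub_cancel] at h
    have t12 : e 1 + e 2 ∈ T := by
      have h := T.sub_mem (T.sub_mem (T.smul_mem (-2 : ℂ) t4) t0) (a4 ▸ hA (e 4))
      rwa [sub_sub_cancel] at h
    rw [hS, Submodule.span_le]
    rintro _ (rfl | rfl | rfl | rfl | rfl) <;> assumption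
end

section
/- Let V₁, V₂, μ and I := μ(V₁, eC − eR) + μ(V₁, eR + eL1 + eL2) be as given. Then for complex numbers t₁, t₂, the element t₁·geL1 + t₂·geL2 of V₂ lies in I if and only if t₁ = t₂. -/
/-- If a linear map sends every standard basis vector to a vector whose coordinates `j` and `k`
agree, then these coordinates agree on its whole range. -/
theorem apply_eq_apply_of_basis (f : (Fin 7 → ℂ) →ₗ[ℂ] (Fin 7 → ℂ)) {j k : Fin 7}
    (h : ∀ i, f (e i) j = f (e i) k) (v : Fin 7 → ℂ) : f v j = f v k := by
  have hf : LinearMap.proj j ∘ₗ f = LinearMap.proj k ∘ₗ f :=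
    (Pi.basisFun ℂ (Fin 7)).ext fun i => by simpa [e] using h i
  exact LinearMap.congr_fun hf v

/-- Let `μ : V₁ × V₁ → V₂` be the symmetric bilinear multiplication map
`H^{1,1}(X) × H^{1,1}(X) → H^{2,2}(X)` given by the multiplication table of the paper, and let
`I = μ(V₁, eC − eR) + μ(V₁, eR + eL1 + eL2)` be the indeterminacy subspace of the ABC-Massey
product.  Then for complex numbers `t₁, t₂`, the element `t₁·geL1 + t₂·geL2` of `V₂` lies in
`I` if and only if `t₁ = t₂`. -/
theorem massey_value_in_indeterminacy_iff
    (μ : (Fin 7 → ℂ) →ₗ[ℂ] (Fin 7 → ℂ) →ₗ[ℂ] (Fin 7 → ℂ))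
    (hsymm : ∀ v w, μ v w = μ w v)
    -- row g
    (h00 : μ (e 0) (e 0) = e 0)
    (h01 : μ (e 0) (e 1) = 0)
    (h02 : μ (e 0) (e 2) = 0)
    (h03 : μ (e 0) (e 3) = 0)
    (h04 : μ (e 0) (e 4) = e 4)
    (h05 : μ (e 0) (e 5) = e 5)
    (h06 : μ (e 0) (e 6) = e 6)
    -- row eP
    (h11 : μ (e 1) (e 1) = e 1)
    (h12 : μ (e 1) (e 2) = 0)
    (h13 : μ (e 1) (e 3) = 0)
    (h14 : μ (e 1) (e 4) = e 4)
    (h15 : μ (e 1) (e 5) = 0)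
    (h16 : μ (e 1) (e 6) = 0)
    -- row eQ
    (h22 : μ (e 2) (e 2) = e 2)
    (h23 : μ (e 2) (e 3) = 0)
    (h24 : μ (e 2) (e 4) = e 4)
    (h25 : μ (e 2) (e 5) = 0)
    (h26 : μ (e 2) (e 6) = 0)
    -- row eR
    (h33 : μ (e 3) (e 3) = e 3)
    (h34 : μ (e 3) (e 4) = 0)
    (h35 : μ (e 3) (e 5) = e 5)
    (h36 : μ (e 3) (e 6) = e 6)
    -- row eC
    (h44 : μ (e 4) (e 4) = (-2 : ℂ) • e 4 - e 0 - e 1 - e 2)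
    (h45 : μ (e 4) (e 5) = e 5)
    (h46 : μ (e 4) (e 6) = e 6)
    -- row eL1
    (h55 : μ (e 5) (e 5) = - e 5 - e 0 - e 3 + e 4)
    (h56 : μ (e 5) (e 6) = 0)
    -- row eL2
    (h66 : μ (e 6) (e 6) = - e 6 - e 0 - e 3 + e 4) :
    ∀ t₁ t₂ : ℂ,
      (t₁ • e 5 + t₂ • e 6 ∈
        LinearMap.range (μ.flip (e 4 - e 3)) ⊔ LinearMap.range (μ.flip (e 3 + e 5 + e 6)))
      ↔ t₁ = t₂ := by
  intro t₁ t₂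
  constructor
  · intro h
    obtain ⟨_, ⟨v, rfl⟩, _, ⟨w, rfl⟩, hvw⟩ := Submodule.mem_sup.mp h
    have hv : μ.flip (e 4 - e 3) v 5 = μ.flip (e 4 - e 3) v 6 := by
      refine apply_eq_apply_of_basis _ (fun i => ?_) v
      fin_cases i <;>
        simp [h03, h04, h13, h14, h23, h24, h33, h34, h44, hsymm (e 4) (e 3),
          hsymm (e 5) (e 3), hsymm (e 5) (e 4), hsymm (e 6) (e 3), hsymm (e 6) (e 4),
          h35, h36, h45, h46] <;>
        simp [e]
    have hw : μ.flip (e 3 + e 5 + e 6) w 5 = μ.flip (e 3 + e 5 + e 6) w 6 := by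
      refine apply_eq_apply_of_basis _ (fun i => ?_) w
      fin_cases i <;>
        simp [h03, h05, h06, h13, h15, h16, h23, h25, h26, h33, h35, h36, hsymm (e 4) (e 3),
          h34, h45, h46, hsymm (e 5) (e 3), h55, h56, hsymm (e 6) (e 3), hsymm (e 6) (e 5),
          h66] <;>
        simp [e]
    have h5 := congrFun hvw 5
    have h6 := congrFun hvw 6
    rw [Pi.add_apply, hv, hw, ← Pi.add_apply, h6] at h5
    simpa [e] using h5.symm
  · rintro rfl
    refine Submodule.mem_sup_right ⟨t₁ • e 0, ?_⟩
    simp [h03, h05, h06]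
end

section
/- Let A be a commutative bigraded bidifferential algebra over ℂ. Let α, β, γ ∈ A be homogeneous of total degrees k₁, k₂, k₃ with ∂α = ∂̄α = 0, ∂β = ∂̄β = 0, ∂γ = ∂̄γ = 0, and let x, y ∈ A be homogeneous of total degrees k₁+k₂−2 and k₂+k₃−2 with αβ = i·∂∂̄x and βγ = i·∂∂̄y. Then ∂∂̄(αy − xγ) = 0; in particular the Aeppli–Bott–Chern–Massey representative αy − xγ defines a class in the Aeppli cohomology H_A(A). -/
/-- A commutative bigraded bidifferential algebra (cbba) over `ℂ`: an `(ℕ × ℕ)`-graded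
associative unital `ℂ`-algebra `A = ⊕_{p,q} A^{p,q}`, graded-commutative with respect to the
total degree, with `ℂ`-linear maps `∂ : A^{p,q} → A^{p+1,q}` (here `D`) and
`∂̄ : A^{p,q} → A^{p,q+1}` (here `Dbar`) satisfying `∂² = 0`, `∂̄² = 0`, `∂∂̄ + ∂̄∂ = 0`, and
the graded Leibniz rules. -/
structure CBBA where
  A : Type
  [ringA : Ring A]
  [algA : Algebra ℂ A]
  /-- the bigrading `A^{p,q}` -/
  gr : ℕ → ℕ → Submodule ℂ A
  /-- `A` is the internal direct sum of the `A^{p,q}` -/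
  internal : DirectSum.IsInternal (fun pq : ℕ × ℕ => gr pq.1 pq.2)
  one_mem : (1 : A) ∈ gr 0 0
  mul_mem : ∀ {p q p' q' : ℕ} {a b : A}, a ∈ gr p q → b ∈ gr p' q' →
      a * b ∈ gr (p + p') (q + q')
  /-- graded commutativity with respect to the total degree -/
  comm : ∀ {p q p' q' : ℕ} {a b : A}, a ∈ gr p q → b ∈ gr p' q' →
      a * b = ((-1 : ℂ) ^ ((p + q) * (p' + q'))) • (b * a)
  /-- the operator `∂` -/
  D : A →ₗ[ℂ] A
  /-- the operator `∂̄` -/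
  Dbar : A →ₗ[ℂ] A
  D_mem : ∀ {p q : ℕ} {a : A}, a ∈ gr p q → D a ∈ gr (p + 1) q
  Dbar_mem : ∀ {p q : ℕ} {a : A}, a ∈ gr p q → Dbar a ∈ gr p (q + 1)
  D_sq : ∀ a : A, D (D a) = 0
  Dbar_sq : ∀ a : A, Dbar (Dbar a) = 0
  anticomm : ∀ a : A, D (Dbar a) + Dbar (D a) = 0
  leibniz_D : ∀ {p q : ℕ} {a : A}, a ∈ gr p q → ∀ b : A,
      D (a * b) = D a * b + ((-1 : ℂ) ^ (p + q)) • (a * D b)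
  leibniz_Dbar : ∀ {p q : ℕ} {a : A}, a ∈ gr p q → ∀ b : A,
      Dbar (a * b) = Dbar a * b + ((-1 : ℂ) ^ (p + q)) • (a * Dbar b)

attribute [instance] CBBA.ringA CBBA.algA

/-- An element of a cbba is homogeneous of total degree `k` if it lies in
`A^k = ⊕_{p+q=k} A^{p,q}`. -/
def CBBA.Homog (C : CBBA) (a : C.A) (k : ℕ) : Prop :=
  a ∈ ⨆ (p : ℕ) (q : ℕ) (_ : p + q = k), C.gr p q

/-- Induction principle for elements homogeneous of a given total degree. -/
theorem CBBA.Homog.induction {C : CBBA} {k : ℕ} {P : C.A → Prop}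
    (mem : ∀ p q, p + q = k → ∀ a ∈ C.gr p q, P a) (zero : P 0)
    (add : ∀ a b, P a → P b → P (a + b)) {a : C.A} (ha : C.Homog a k) : P a := by
  unfold CBBA.Homog at ha
  induction ha using Submodule.iSup_induction' with
  | zero => exact zero
  | add a b _ _ iha ihb => exact add a b iha ihb
  | mem p a ha =>
    induction ha using Submodule.iSup_induction' with
    | zero => exact zero
    | add a b _ _ iha ihb => exact add a b iha ihb
    | mem q a ha =>
      induction ha using Submodule.iSup_induction' with
      | zero => exact zero
      | add a b _ _ iha ihb => exact add a b iha ihb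
      | mem h a ha => exact mem p q h a ha

theorem CBBA.Homog.of_mem {C : CBBA} {p q : ℕ} {a : C.A} (ha : a ∈ C.gr p q) :
    C.Homog a (p + q) :=
  Submodule.mem_iSup_of_mem p <| Submodule.mem_iSup_of_mem q <|
    Submodule.mem_iSup_of_mem rfl ha

theorem CBBA.Homog.dbar {C : CBBA} {k : ℕ} {a : C.A} (ha : C.Homog a k) :
    C.Homog (C.Dbar a) (k + 1) := by
  refine ha.induction (P := fun a => C.Homog (C.Dbar a) (k + 1)) ?_ ?_ ?_
  · rintro p q rfl a ha
    exact CBBA.Homog.of_mem (p := p) (q := q + 1) (C.Dbar_mem ha)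
  · rw [map_zero]
    exact Submodule.zero_mem _
  · intro a b ha hb
    rw [map_add]
    exact Submodule.add_mem _ ha hb

/-- The graded Leibniz rule for `∂` on elements homogeneous of total degree `k`. -/
theorem CBBA.Homog.leibniz_D {C : CBBA} {k : ℕ} {a : C.A} (ha : C.Homog a k) (b : C.A) :
    C.D (a * b) = C.D a * b + ((-1 : ℂ) ^ k) • (a * C.D b) := by
  refine ha.induction
    (P := fun a => C.D (a * b) = C.D a * b + ((-1 : ℂ) ^ k) • (a * C.D b)) ?_ ?_ ?_
  · rintro p q rfl a ha
    exact C.leibniz_D ha b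
  · simp
  · intro a₁ a₂ h₁ h₂
    simp only [add_mul, map_add, smul_add, h₁, h₂]
    abel

/-- The graded Leibniz rule for `∂̄` on elements homogeneous of total degree `k`. -/
theorem CBBA.Homog.leibniz_Dbar {C : CBBA} {k : ℕ} {a : C.A} (ha : C.Homog a k) (b : C.A) :
    C.Dbar (a * b) = C.Dbar a * b + ((-1 : ℂ) ^ k) • (a * C.Dbar b) := by
  refine ha.induction
    (P := fun a => C.Dbar (a * b) = C.Dbar a * b + ((-1 : ℂ) ^ k) • (a * C.Dbar b)) ?_ ?_ ?_
  · rintro p q rfl a ha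
    exact C.leibniz_Dbar ha b
  · simp
  · intro a₁ a₂ h₁ h₂
    simp only [add_mul, map_add, smul_add, h₁, h₂]
    abel

/-- `∂∂̄` commutes with left multiplication by a closed homogeneous element. -/
theorem CBBA.Homog.ddbar_mul_left {C : CBBA} {k : ℕ} {a : C.A} (ha : C.Homog a k)
    (haD : C.D a = 0) (haDb : C.Dbar a = 0) (b : C.A) :
    C.D (C.Dbar (a * b)) = a * C.D (C.Dbar b) := by
  rw [ha.leibniz_Dbar, haDb, zero_mul, zero_add, map_smul, ha.leibniz_D, haD, zero_mul,
    zero_add, smul_smul, ← mul_pow]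
  simp

/-- `∂∂̄` commutes with right multiplication by a closed element. -/
theorem CBBA.Homog.ddbar_mul_right {C : CBBA} {k : ℕ} {a : C.A} (ha : C.Homog a k)
    {b : C.A} (hbD : C.D b = 0) (hbDb : C.Dbar b = 0) :
    C.D (C.Dbar (a * b)) = C.D (C.Dbar a) * b := by
  rw [ha.leibniz_Dbar, hbDb, mul_zero, smul_zero, add_zero, ha.dbar.leibniz_D, hbD, mul_zero,
    smul_zero, add_zero]

/-- If `α, β, γ` are `∂`- and `∂̄`-closed homogeneous elements of total
degrees `k₁, k₂, k₃` and `x, y` are homogeneous of total degrees `k₁+k₂−2`, `k₂+k₃−2` with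
`αβ = i∂∂̄x` and `βγ = i∂∂̄y`, then `∂∂̄(αy − xγ) = 0`; in particular the
Aeppli–Bott–Chern–Massey representative `αy − xγ` defines a class in the Aeppli
cohomology `H_A = ker ∂∂̄ / (im ∂ + im ∂̄)`. -/
theorem abc_massey_representative_ddbar_closed (C : CBBA) (k₁ k₂ k₃ : ℕ)
    (α β γ x y : C.A)
    (hα : C.Homog α k₁) (hβ : C.Homog β k₂) (hγ : C.Homog γ k₃)
    (hx : C.Homog x (k₁ + k₂ - 2)) (hy : C.Homog y (k₂ + k₃ - 2))
    (hαD : C.D α = 0) (hαDb : C.Dbar α = 0)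
    (hβD : C.D β = 0) (hβDb : C.Dbar β = 0)
    (hγD : C.D γ = 0) (hγDb : C.Dbar γ = 0)
    (hxab : α * β = Complex.I • C.D (C.Dbar x))
    (hybc : β * γ = Complex.I • C.D (C.Dbar y)) :
    C.D (C.Dbar (α * y - x * γ)) = 0 := by
  rw [map_sub, map_sub, hα.ddbar_mul_left hαD hαDb, hx.ddbar_mul_right hγD hγDb]
  have key : Complex.I • (α * C.D (C.Dbar y)) = Complex.I • (C.D (C.Dbar x) * γ) := by
    rw [← mul_smul_comm, ← smul_mul_assoc, ← hxab, ← hybc, mul_assoc]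
  exact sub_eq_zero.mpr (smul_right_injective C.A Complex.I_ne_zero key)
end

section
/- Let A be a commutative bigraded bidifferential algebra over ℂ. Let α, β, γ ∈ A be homogeneous of total degrees k₁, k₂, k₃ with ∂α = ∂̄α = 0, ∂β = ∂̄β = 0, ∂γ = ∂̄γ = 0, and x, y ∈ A homogeneous with αβ = i∂∂̄x and βγ = i∂∂̄y. Let w ∈ A be homogeneous of total degree k₂ − 2 and set β' = β + i∂∂̄w. Then: (1) ∂β' = 0 and ∂̄β' = 0; (2) αβ' = i∂∂̄(x + αw) and β'γ = i∂∂̄(y + wγ); (3) α(y + wγ) − (x + αw)γ = αy − xγ, i.e. the Aeppli–Bott–Chern–Massey representative is literally unchanged: the ABC-Massey product depends only on the Bott–Chern class of β. -/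
namespace CBBA

variable {C : CBBA}

/-- The graded Leibniz rule for `∂` on elements of pure total degree. -/
theorem Homog.D_mul {a : C.A} {k : ℕ} (ha : C.Homog a k) (b : C.A) :
    C.D (a * b) = C.D a * b + ((-1 : ℂ) ^ k) • (a * C.D b) := by
  have h : (⨆ (p : ℕ) (q : ℕ) (_ : p + q = k), C.gr p q) ≤
      LinearMap.eqLocus (C.D ∘ₗ LinearMap.mulRight ℂ b)
        (LinearMap.mulRight ℂ b ∘ₗ C.D + ((-1 : ℂ) ^ k) • LinearMap.mulRight ℂ (C.D b)) := by
    refine iSup_le fun p => iSup_le fun q => iSup_le fun hpq c hc => ?_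
    subst hpq
    exact C.leibniz_D hc b
  exact h ha

/-- The graded Leibniz rule for `∂̄` on elements of pure total degree. -/
theorem Homog.Dbar_mul {a : C.A} {k : ℕ} (ha : C.Homog a k) (b : C.A) :
    C.Dbar (a * b) = C.Dbar a * b + ((-1 : ℂ) ^ k) • (a * C.Dbar b) := by
  have h : (⨆ (p : ℕ) (q : ℕ) (_ : p + q = k), C.gr p q) ≤
      LinearMap.eqLocus (C.Dbar ∘ₗ LinearMap.mulRight ℂ b)
        (LinearMap.mulRight ℂ b ∘ₗ C.Dbar +
          ((-1 : ℂ) ^ k) • LinearMap.mulRight ℂ (C.Dbar b)) := by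
    refine iSup_le fun p => iSup_le fun q => iSup_le fun hpq c hc => ?_
    subst hpq
    exact C.leibniz_Dbar hc b
  exact h ha

/-- `∂` is linear over right multiplication by a `∂`-closed element. -/
theorem D_mul_of_closed (a : C.A) {b : C.A} (hb : C.D b = 0) :
    C.D (a * b) = C.D a * b := by
  have h : (⨆ pq : ℕ × ℕ, C.gr pq.1 pq.2) ≤
      LinearMap.eqLocus (C.D ∘ₗ LinearMap.mulRight ℂ b) (LinearMap.mulRight ℂ b ∘ₗ C.D) := by
    refine iSup_le fun pq a ha => ?_
    simpa [hb] using C.leibniz_D ha b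
  rw [C.internal.submodule_iSup_eq_top] at h
  exact h (Submodule.mem_top (x := a))

/-- `∂̄` is linear over right multiplication by a `∂̄`-closed element. -/
theorem Dbar_mul_of_closed (a : C.A) {b : C.A} (hb : C.Dbar b = 0) :
    C.Dbar (a * b) = C.Dbar a * b := by
  have h : (⨆ pq : ℕ × ℕ, C.gr pq.1 pq.2) ≤
      LinearMap.eqLocus (C.Dbar ∘ₗ LinearMap.mulRight ℂ b)
        (LinearMap.mulRight ℂ b ∘ₗ C.Dbar) := by
    refine iSup_le fun pq a ha => ?_
    simpa [hb] using C.leibniz_Dbar ha b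
  rw [C.internal.submodule_iSup_eq_top] at h
  exact h (Submodule.mem_top (x := a))

/-- `∂∂̄` is linear over left multiplication by a closed element of pure total degree. -/
theorem Homog.D_Dbar_mul {a : C.A} {k : ℕ} (ha : C.Homog a k) (hD : C.D a = 0)
    (hDbar : C.Dbar a = 0) (b : C.A) :
    C.D (C.Dbar (a * b)) = a * C.D (C.Dbar b) := by
  rw [ha.Dbar_mul, hDbar, zero_mul, zero_add, map_smul, ha.D_mul, hD, zero_mul, zero_add,
    smul_smul, ← mul_pow]
  simp

/-- `∂∂̄` is linear over right multiplication by a closed element. -/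
theorem D_Dbar_mul_of_closed (a : C.A) {b : C.A} (hD : C.D b = 0) (hDbar : C.Dbar b = 0) :
    C.D (C.Dbar (a * b)) = C.D (C.Dbar a) * b := by
  rw [Dbar_mul_of_closed a hDbar, D_mul_of_closed _ hD]

/-- The image of `∂∂̄` is `∂̄`-closed. -/
theorem Dbar_D_Dbar (a : C.A) : C.Dbar (C.D (C.Dbar a)) = 0 := by
  simpa [C.Dbar_sq] using C.anticomm (C.Dbar a)

end CBBA

/-- Changing the middle Bott–Chern representative `β` to `β' = β + i∂∂̄w`
(with `w` homogeneous of total degree `k₂ − 2`): (1) `β'` is again `∂`- and `∂̄`-closed;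
(2) `αβ' = i∂∂̄(x + αw)` and `β'γ = i∂∂̄(y + wγ)`; (3) the Aeppli–Bott–Chern–Massey
representative is literally unchanged: `α(y + wγ) − (x + αw)γ = αy − xγ`.  Hence the
ABC-Massey product depends only on the Bott–Chern class of `β`. -/
theorem abc_massey_independent_of_BC_representative_middle (C : CBBA)
    (k₁ k₂ k₃ l₁ l₂ : ℕ) (α β γ x y w : C.A)
    (hα : C.Homog α k₁) (hβ : C.Homog β k₂) (hγ : C.Homog γ k₃)
    (hx : C.Homog x l₁) (hy : C.Homog y l₂) (hw : C.Homog w (k₂ - 2))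
    (hαD : C.D α = 0) (hαDb : C.Dbar α = 0)
    (hβD : C.D β = 0) (hβDb : C.Dbar β = 0)
    (hγD : C.D γ = 0) (hγDb : C.Dbar γ = 0)
    (hxab : α * β = Complex.I • C.D (C.Dbar x))
    (hybc : β * γ = Complex.I • C.D (C.Dbar y)) :
    (C.D (β + Complex.I • C.D (C.Dbar w)) = 0 ∧
     C.Dbar (β + Complex.I • C.D (C.Dbar w)) = 0) ∧
    (α * (β + Complex.I • C.D (C.Dbar w)) = Complex.I • C.D (C.Dbar (x + α * w)) ∧
     (β + Complex.I • C.D (C.Dbar w)) * γ = Complex.I • C.D (C.Dbar (y + w * γ))) ∧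
    α * (y + w * γ) - (x + α * w) * γ = α * y - x * γ := by
  refine ⟨⟨?_, ?_⟩, ⟨?_, ?_⟩, ?_⟩
  · simp [hβD, C.D_sq]
  · simp [hβDb, CBBA.Dbar_D_Dbar]
  · rw [map_add, map_add, hα.D_Dbar_mul hαD hαDb, mul_add, mul_smul_comm, smul_add, hxab]
  · rw [map_add, map_add, CBBA.D_Dbar_mul_of_closed w hγD hγDb, add_mul, smul_mul_assoc,
      smul_add, hybc]
  · noncomm_ring
end

section
/- Let φ : A → B be a morphism of commutative bigraded bidifferential algebras over ℂ, i.e. a unital ℂ-algebra homomorphism with φ(A^{p,q}) ⊆ B^{p,q}, φ∘∂ = ∂∘φ and φ∘∂̄ = ∂̄∘φ. Let α, β, γ ∈ A¹ = A^{1,0} ⊕ A^{0,1} satisfy ∂α = ∂̄α = 0, ∂β = ∂̄β = 0, ∂γ = ∂̄γ = 0, and let x, y ∈ A⁰ = A^{0,0} satisfy αβ = i∂∂̄x and βγ = i∂∂̄y. Assume: (i) the induced map H_A¹(A) → H_A¹(B) on Aeppli cohomology in total degree 1 is injective; (ii) every class in H_A⁰(B) is a ℂ-scalar multiple of the class of the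 unit 1. If the class of αy − xγ in H_A¹(A) is not the class of any element of the form αu + vγ with u, v ∈ A⁰ and ∂∂̄u = ∂∂̄v = 0, then the class of (φα)(φy) − (φx)(φγ) in H_A¹(B) is not the class of any element of the form (φα)u' + v'(φγ) with u', v' ∈ B⁰ and ∂∂̄u' = ∂∂̄v' = 0. (In other words: under (i) and (ii), a nontrivial ABC-Massey product of degree-1 classes pulls back to a nontrivial ABC-Massey product.) -/
namespace CBBA

variable (C : CBBA)

theorem range_le_iSup_gr_ne_zero :
    LinearMap.range C.D ⊔ LinearMap.range C.Dbar ≤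
      ⨆ (pq : ℕ × ℕ) (_ : pq ≠ (0, 0)), C.gr pq.1 pq.2 := by
  have htop := C.internal.submodule_iSup_eq_top
  rw [LinearMap.range_eq_map, LinearMap.range_eq_map, ← htop, Submodule.map_iSup,
    Submodule.map_iSup]
  refine sup_le (iSup_le fun pq => ?_) (iSup_le fun pq => ?_)
  · rw [Submodule.map_le_iff_le_comap]
    intro a ha
    exact Submodule.mem_iSup_of_mem (pq.1 + 1, pq.2)
      (Submodule.mem_iSup_of_mem (by simp) (C.D_mem ha))
  · rw [Submodule.map_le_iff_le_comap]
    intro a ha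
    exact Submodule.mem_iSup_of_mem (pq.1, pq.2 + 1)
      (Submodule.mem_iSup_of_mem (by simp) (C.Dbar_mem ha))

theorem disjoint_gr_zero_range :
    Disjoint (C.gr 0 0) (LinearMap.range C.D ⊔ LinearMap.range C.Dbar) :=
  (C.internal.submodule_iSupIndep (0, 0)).mono_right C.range_le_iSup_gr_ne_zero

theorem Dbar_one : C.Dbar 1 = 0 := by
  simpa using C.leibniz_Dbar C.one_mem 1

variable {C}

theorem D_mul_of_mem_one {a : C.A} (ha : a ∈ C.gr 1 0 ⊔ C.gr 0 1) (b : C.A) :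
    C.D (a * b) = C.D a * b - a * C.D b := by
  obtain ⟨a₁, h₁, a₂, h₂, rfl⟩ := Submodule.mem_sup.1 ha
  simp only [add_mul, map_add, C.leibniz_D h₁, C.leibniz_D h₂]
  simp only [add_zero, zero_add, pow_one, neg_smul, one_smul]
  abel

theorem Dbar_mul_of_mem_one {a : C.A} (ha : a ∈ C.gr 1 0 ⊔ C.gr 0 1) (b : C.A) :
    C.Dbar (a * b) = C.Dbar a * b - a * C.Dbar b := by
  obtain ⟨a₁, h₁, a₂, h₂, rfl⟩ := Submodule.mem_sup.1 ha
  simp only [add_mul, map_add, C.leibniz_Dbar h₁, C.leibniz_Dbar h₂]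
  simp only [add_zero, zero_add, pow_one, neg_smul, one_smul]
  abel

theorem D_Dbar_mul_left {a : C.A} (ha : a ∈ C.gr 1 0 ⊔ C.gr 0 1) (haD : C.D a = 0)
    (haDb : C.Dbar a = 0) (b : C.A) : C.D (C.Dbar (a * b)) = a * C.D (C.Dbar b) := by
  simp [Dbar_mul_of_mem_one ha, D_mul_of_mem_one ha, haD, haDb]

theorem D_Dbar_mul_right {f a : C.A} (hf : f ∈ C.gr 0 0) (haD : C.D a = 0)
    (haDb : C.Dbar a = 0) : C.D (C.Dbar (f * a)) = C.D (C.Dbar f) * a := by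
  simp [C.leibniz_Dbar hf, C.leibniz_D (C.Dbar_mem hf), haD, haDb]

theorem mul_mem_one_left {a f : C.A} (ha : a ∈ C.gr 1 0 ⊔ C.gr 0 1) (hf : f ∈ C.gr 0 0) :
    a * f ∈ C.gr 1 0 ⊔ C.gr 0 1 := by
  obtain ⟨a₁, h₁, a₂, h₂, rfl⟩ := Submodule.mem_sup.1 ha
  rw [add_mul]
  exact Submodule.add_mem_sup (C.mul_mem h₁ hf) (C.mul_mem h₂ hf)

theorem mul_mem_one_right {f a : C.A} (hf : f ∈ C.gr 0 0) (ha : a ∈ C.gr 1 0 ⊔ C.gr 0 1) :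
    f * a ∈ C.gr 1 0 ⊔ C.gr 0 1 := by
  obtain ⟨a₁, h₁, a₂, h₂, rfl⟩ := Submodule.mem_sup.1 ha
  rw [mul_add]
  exact Submodule.add_mem_sup (by simpa using C.mul_mem hf h₁) (by simpa using C.mul_mem hf h₂)

/-- A degree-zero element Aeppli-cohomologous to a scalar is that scalar: there are no exact
elements in bidegree `(0, 0)`. -/
theorem eq_smul_one_of_sub_mem_range {b : C.A} (hb : b ∈ C.gr 0 0) {c : ℂ}
    (h : b - c • (1 : C.A) ∈ LinearMap.range C.D ⊔ LinearMap.range C.Dbar) :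
    b = c • (1 : C.A) :=
  sub_eq_zero.1 <| Submodule.disjoint_def.1 C.disjoint_gr_zero_range _
    (sub_mem hb (Submodule.smul_mem _ c C.one_mem)) h

end CBBA

/-- Let `φ : A → B` be a morphism of cbbas (a unital `ℂ`-algebra map
preserving the bigrading and commuting with `∂` and `∂̄`).  Let `α, β, γ ∈ A¹ = A^{1,0} ⊕ A^{0,1}`
be `∂`,`∂̄`-closed, and `x, y ∈ A⁰ = A^{0,0}` with `αβ = i∂∂̄x`, `βγ = i∂∂̄y`.  Assume:
(i) the induced map on Aeppli cohomology in total degree 1 is injective, and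
(ii) every degree-0 Aeppli class of `B` is a `ℂ`-multiple of the class of `1`.
If the class of `αy − xγ` in `H_A¹(A)` is not the class of any `αu + vγ` with `u,v ∈ A⁰`,
`∂∂̄u = ∂∂̄v = 0`, then the class of `(φα)(φy) − (φx)(φγ)` in `H_A¹(B)` is not the class of any
`(φα)u' + v'(φγ)` with `u',v' ∈ B⁰`, `∂∂̄u' = ∂∂̄v' = 0`: nontrivial ABC-Massey products of
degree-1 classes pull back to nontrivial ABC-Massey products. -/
theorem abc_massey_nontrivial_pullback (C Cb : CBBA) (φ : C.A →ₐ[ℂ] Cb.A)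
    (hφgr : ∀ (p q : ℕ) (a : C.A), a ∈ C.gr p q → φ a ∈ Cb.gr p q)
    (hφD : ∀ a : C.A, φ (C.D a) = Cb.D (φ a))
    (hφDb : ∀ a : C.A, φ (C.Dbar a) = Cb.Dbar (φ a))
    (α β γ x y : C.A)
    (hα1 : α ∈ C.gr 1 0 ⊔ C.gr 0 1) (hβ1 : β ∈ C.gr 1 0 ⊔ C.gr 0 1)
    (hγ1 : γ ∈ C.gr 1 0 ⊔ C.gr 0 1)
    (hx0 : x ∈ C.gr 0 0) (hy0 : y ∈ C.gr 0 0)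
    (hαD : C.D α = 0) (hαDb : C.Dbar α = 0)
    (hβD : C.D β = 0) (hβDb : C.Dbar β = 0)
    (hγD : C.D γ = 0) (hγDb : C.Dbar γ = 0)
    (hxab : α * β = Complex.I • C.D (C.Dbar x))
    (hybc : β * γ = Complex.I • C.D (C.Dbar y))
    -- (i) injectivity of H_A¹(A) → H_A¹(B)
    (hinj : ∀ a : C.A, a ∈ C.gr 1 0 ⊔ C.gr 0 1 → C.D (C.Dbar a) = 0 →
      φ a ∈ LinearMap.range Cb.D ⊔ LinearMap.range Cb.Dbar →
      a ∈ LinearMap.range C.D ⊔ LinearMap.range C.Dbar)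
    -- (ii) H_A⁰(B) is spanned by the class of 1
    (hH0 : ∀ b : Cb.A, b ∈ Cb.gr 0 0 → Cb.D (Cb.Dbar b) = 0 →
      ∃ c : ℂ, b - c • (1 : Cb.A) ∈ LinearMap.range Cb.D ⊔ LinearMap.range Cb.Dbar)
    -- nontriviality of the ABC-Massey product in A
    (hnontriv : ¬ ∃ u v : C.A, u ∈ C.gr 0 0 ∧ v ∈ C.gr 0 0 ∧
      C.D (C.Dbar u) = 0 ∧ C.D (C.Dbar v) = 0 ∧
      (α * y - x * γ) - (α * u + v * γ) ∈ LinearMap.range C.D ⊔ LinearMap.range C.Dbar) :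
    ¬ ∃ u' v' : Cb.A, u' ∈ Cb.gr 0 0 ∧ v' ∈ Cb.gr 0 0 ∧
      Cb.D (Cb.Dbar u') = 0 ∧ Cb.D (Cb.Dbar v') = 0 ∧
      (φ α * φ y - φ x * φ γ) - (φ α * u' + v' * φ γ)
        ∈ LinearMap.range Cb.D ⊔ LinearMap.range Cb.Dbar := by
  rintro ⟨u', v', hu', hv', hu'c, hv'c, hmem⟩
  obtain ⟨c, hc⟩ := hH0 u' hu' hu'c
  obtain ⟨e, he⟩ := hH0 v' hv' hv'c
  obtain rfl := CBBA.eq_smul_one_of_sub_mem_range hu' hc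
  obtain rfl := CBBA.eq_smul_one_of_sub_mem_range hv' he
  have hscalar (t : ℂ) : t • (1 : C.A) ∈ C.gr 0 0 := Submodule.smul_mem _ t C.one_mem
  have hscalar_closed (t : ℂ) : C.D (C.Dbar (t • (1 : C.A))) = 0 := by simp [C.Dbar_one]
  refine hnontriv ⟨c • 1, e • 1, hscalar c, hscalar e, hscalar_closed c, hscalar_closed e,
    hinj _ ?_ ?_ ?_⟩
  · exact sub_mem
      (sub_mem (CBBA.mul_mem_one_left hα1 hy0) (CBBA.mul_mem_one_right hx0 hγ1))
      (add_mem (CBBA.mul_mem_one_left hα1 (hscalar c)) (CBBA.mul_mem_one_right (hscalar e) hγ1))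
  · have hassoc : α * C.D (C.Dbar y) = C.D (C.Dbar x) * γ := by
      have h : Complex.I • (α * C.D (C.Dbar y)) = Complex.I • (C.D (C.Dbar x) * γ) := by
        rw [← mul_smul_comm, ← hybc, ← smul_mul_assoc, ← hxab, mul_assoc]
      exact smul_right_injective _ Complex.I_ne_zero h
    simp only [map_sub, map_add, CBBA.D_Dbar_mul_left hα1 hαD hαDb,
      CBBA.D_Dbar_mul_right hx0 hγD hγDb, CBBA.D_Dbar_mul_right (hscalar e) hγD hγDb,
      hscalar_closed, hassoc]
    simp
  · simpa using hmem
end
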